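/- arXiv:2311.04651 — 2 statements merged into one kernel-verified Lean document; each statement's English description precedes it below -/
import Mathlib

section
/- Pearl's theorem: let B = (G,𝒯) be a Bayesian network over a finite set 𝕏 of names. Then the factor ⟦B⟧ := ⊙_{X∈𝕏} φ^X is a probability distribution over 𝕏, i.e. ∑_{x̄ ∈ Val(𝕏)} ⟦B⟧(x̄) = 1. -/
set_option maxHeartbeats 1000000

noncomputable section
open Classical

namespace HOBN

/-! Fix a countable set of names (represented by `ℕ`); each name `X` carries a
type `V X` of values, assumed finite and nonempty. -/

variable {V : ℕ → Type}

/-- A **factor** over a finite set `names` of names: a function from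
assignments of values to the names to the non-negative reals.  Assignments are
represented as total maps `∀ x, V x`; the field `supp` states that the factor
only depends on the values of the names in `names` (so that `f` represents a
function `Val(names) → ℝ≥0`). -/
structure Factor (V : ℕ → Type) where
  names : Finset ℕ
  f : (∀ x : ℕ, V x) → NNReal
  supp : ∀ a b : (∀ x : ℕ, V x), (∀ x ∈ names, a x = b x) → f a = f b

/-- The trivial factor `1_∅`. -/
def Factor.one (V : ℕ → Type) : Factor V :=
  ⟨∅, fun _ => 1, fun _ _ _ => rfl⟩

/-- **Product of factors**: `(φ₁ ⊙ φ₂)(z̄) = φ₁(z̄↾𝕏)·φ₂(z̄↾𝕐)`, a factor over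
`𝕏 ∪ 𝕐`. -/
def Factor.prod (φ ψ : Factor V) : Factor V where
  names := φ.names ∪ ψ.names
  f := fun a => φ.f a * ψ.f a
  supp := by
    intro a b h
    show φ.f a * ψ.f a = φ.f b * ψ.f b
    rw [φ.supp a b fun x hx => h x (Finset.mem_union_left _ hx),
        ψ.supp a b fun x hx => h x (Finset.mem_union_right _ hx)]

/-- **Sum-out** of a set `Z` of names from a factor `φ`:
`(∑_Z φ)(ȳ) = ∑_{z̄ ∈ Val(Z)} φ(z̄ȳ)`, a factor over `φ.names \ Z`. -/
def Factor.sumOut [∀ x, Fintype (V x)] (Z : Finset ℕ) (φ : Factor V) : Factor V where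
  names := φ.names \ Z
  f := fun a =>
    ∑ w : (∀ x : ↥(φ.names ∩ Z), V ↑x),
      φ.f (fun x => if hx : x ∈ φ.names ∩ Z then w ⟨x, hx⟩ else a x)
  supp := by
    intro a b h
    show ∑ w : (∀ x : ↥(φ.names ∩ Z), V ↑x), _ = ∑ w : (∀ x : ↥(φ.names ∩ Z), V ↑x), _
    refine Finset.sum_congr rfl fun w _ => φ.supp _ _ fun x hx => ?_
    by_cases hz : x ∈ φ.names ∩ Z
    · simp only [dif_pos hz]
    · simp only [dif_neg hz]
      exact h x (Finset.mem_sdiff.mpr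
        ⟨hx, fun hZ => hz (Finset.mem_inter.mpr ⟨hx, hZ⟩)⟩)

/-- A **Bayesian network** over a finite set `vars` of names: a directed
acyclic graph `edge` on `vars` together with, for each `X ∈ vars`, a
conditional probability table: a factor over `{X} ∪ Pa(X)` (where `Pa(X)` is
the set of parents of `X`) which is normalized: for each assignment of the
parents, summing over the values of `X` gives `1`. -/
structure BayesNet (V : ℕ → Type) [∀ x, Fintype (V x)] where
  vars : Finset ℕ
  edge : ℕ → ℕ → Prop
  edge_mem : ∀ {x y : ℕ}, edge x y → x ∈ vars ∧ y ∈ vars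
  acyclic : ∀ x : ℕ, ¬ Relation.TransGen edge x x
  cpt : (X : ℕ) → X ∈ vars → Factor V
  cpt_names : ∀ (X : ℕ) (hX : X ∈ vars),
    (cpt X hX).names = insert X (vars.filter (fun y => edge y X))
  cpt_norm : ∀ (X : ℕ) (hX : X ∈ vars) (a : ∀ x : ℕ, V x),
    ∑ v : V X, (cpt X hX).f (fun y => if h : y = X then (h.symm ▸ v : V y) else a y) = 1

/-- The factor `⟦B⟧ := ⊙_{X ∈ vars} φ^X`, the product of all the conditional
probability tables of the Bayesian network `B`. -/
def BayesNet.sem {V : ℕ → Type} [∀ x, Fintype (V x)] (B : BayesNet V) : Factor V :=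
  (B.vars.attach.toList.map (fun X => B.cpt X.1 X.2)).foldr Factor.prod (Factor.one V)

theorem Factor.foldr_prod_f (l : List (Factor V)) (a : ∀ x : ℕ, V x) :
    (l.foldr Factor.prod (Factor.one V)).f a = (l.map fun φ => φ.f a).prod := by
  induction l with
  | nil => rfl
  | cons φ l ih => simp only [List.foldr_cons, List.map_cons, List.prod_cons, ← ih]; rfl

theorem BayesNet.sem_f [∀ x, Fintype (V x)] (B : BayesNet V) (a : ∀ x : ℕ, V x) :
    B.sem.f a = ∏ X ∈ B.vars.attach, (B.cpt X.1 X.2).f a := by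
  rw [BayesNet.sem, Factor.foldr_prod_f, List.map_map]
  exact Finset.prod_map_toList _ _

/-- The sum of `g` over all reassignments of the names in `S`, starting from `a`. -/
def sumOver [∀ x, Fintype (V x)] (S : Finset ℕ) (g : (∀ x : ℕ, V x) → NNReal)
    (a : ∀ x : ℕ, V x) : NNReal :=
  ∑ w : (∀ x : ↥S, V ↑x), g (fun y => if h : y ∈ S then w ⟨y, h⟩ else a y)

theorem sumOver_empty [∀ x, Fintype (V x)] (g : (∀ x : ℕ, V x) → NNReal) (a : ∀ x : ℕ, V x) :
    sumOver ∅ g a = g a := by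
  simp [sumOver]

/-- Assignments to `insert X S` split into an assignment to `S` and a value of `X`. -/
def insertPiEquiv {S : Finset ℕ} {X : ℕ} (hX : X ∉ S) :
    (∀ x : ↥(insert X S), V ↑x) ≃ (∀ x : ↥S, V ↑x) × V X where
  toFun w := (fun x => w ⟨x.1, Finset.mem_insert_of_mem x.2⟩, w ⟨X, Finset.mem_insert_self X S⟩)
  invFun p x :=
    if h : x.1 = X then h.symm ▸ p.2 else p.1 ⟨x.1, Finset.mem_of_mem_insert_of_ne x.2 h⟩
  left_inv w := by
    funext ⟨x, hx⟩
    rcases eq_or_ne x X with rfl | hne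
    · simp
    · simp [hne]
  right_inv p := by
    refine Prod.ext (funext fun ⟨x, hx⟩ => ?_) ?_
    · have hne : x ≠ X := fun h => hX (h ▸ hx)
      simp [hne]
    · simp

theorem sumOver_insert [∀ x, Fintype (V x)] {S : Finset ℕ} {X : ℕ} (hX : X ∉ S)
    (g : (∀ x : ℕ, V x) → NNReal) (a : ∀ x : ℕ, V x) :
    sumOver (insert X S) g a = sumOver S (fun b => ∑ v, g (Function.update b X v)) a := by
  unfold sumOver
  rw [← Fintype.sum_prod_type']
  refine Fintype.sum_equiv (insertPiEquiv hX) _ _ fun w => congrArg g (funext fun x => ?_)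
  rcases eq_or_ne x X with rfl | hne
  · simp [insertPiEquiv]
  · simp [insertPiEquiv, hne]

theorem BayesNet.exists_sink [∀ x, Fintype (V x)] (B : BayesNet V) {S : Finset ℕ}
    (hS : S.Nonempty) : ∃ X ∈ S, ∀ Y ∈ S, ¬ B.edge X Y := by
  let r : ℕ → ℕ → Prop := fun x y => Relation.TransGen B.edge y x
  have : IsStrictOrder ℕ r :=
    { irrefl := B.acyclic
      trans := fun _ _ _ h₁ h₂ => h₂.trans h₁ }
  obtain ⟨X, hX, hmin⟩ := (S.wellFoundedOn (r := r)).has_min Set.univ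
    ⟨⟨hS.choose, hS.choose_spec⟩, trivial⟩
  exact ⟨X.1, X.2, fun Y hY h => hmin ⟨Y, hY⟩ trivial (.single h)⟩

/-- The conditional probability table of `X`, extended by `1` to names outside the network. -/
def BayesNet.table [∀ x, Fintype (V x)] (B : BayesNet V) (X : ℕ) (a : ∀ x : ℕ, V x) : NNReal :=
  if h : X ∈ B.vars then (B.cpt X h).f a else 1

theorem BayesNet.sum_table [∀ x, Fintype (V x)] (B : BayesNet V) {X : ℕ} (hX : X ∈ B.vars)
    (a : ∀ x : ℕ, V x) : ∑ v, B.table X (Function.update a X v) = 1 := by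
  simp only [BayesNet.table, dif_pos hX]
  rw [← B.cpt_norm X hX a]
  refine Finset.sum_congr rfl fun v _ => congrArg _ (funext fun y => ?_)
  rcases eq_or_ne y X with rfl | hne
  · simp
  · simp [hne]

theorem BayesNet.table_update [∀ x, Fintype (V x)] (B : BayesNet V) {X Y : ℕ} (hne : Y ≠ X)
    (h : ¬ B.edge X Y) (a : ∀ x : ℕ, V x) (v : V X) :
    B.table Y (Function.update a X v) = B.table Y a := by
  unfold BayesNet.table
  split_ifs with hY
  · refine (B.cpt Y hY).supp _ _ fun z hz => Function.update_of_ne ?_ _ _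
    rintro rfl
    rw [B.cpt_names, Finset.mem_insert, Finset.mem_filter] at hz
    exact hz.elim (fun e => hne e.symm) fun e => h e.2
  · rfl

theorem BayesNet.sumOver_prod_table [∀ x, Fintype (V x)] (B : BayesNet V) (S : Finset ℕ)
    (hS : S ⊆ B.vars) (a : ∀ x : ℕ, V x) :
    sumOver S (fun b => ∏ X ∈ S, B.table X b) a = 1 := by
  induction S using Finset.strongInduction with
  | H S ih =>
    rcases S.eq_empty_or_nonempty with rfl | hne
    · simp [sumOver_empty]
    obtain ⟨X, hX, hsink⟩ := B.exists_sink hne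
    have key (b : ∀ x : ℕ, V x) :
        ∑ v, ∏ Y ∈ S, B.table Y (Function.update b X v) = ∏ Y ∈ S.erase X, B.table Y b := by
      have hterm (v : V X) : ∏ Y ∈ S, B.table Y (Function.update b X v) =
          B.table X (Function.update b X v) * ∏ Y ∈ S.erase X, B.table Y b := by
        rw [← Finset.mul_prod_erase S _ hX]
        congr 1
        refine Finset.prod_congr rfl fun Y hY => ?_
        exact B.table_update (Finset.ne_of_mem_erase hY) (hsink Y (Finset.mem_of_mem_erase hY)) b v
      simp only [hterm]
      rw [← Finset.sum_mul, B.sum_table (hS hX), one_mul]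
    have hsum := sumOver_insert (Finset.notMem_erase X S) (fun b => ∏ Y ∈ S, B.table Y b) a
    simp only [key] at hsum
    rw [Finset.insert_erase hX] at hsum
    rw [hsum]
    exact ih _ (Finset.erase_ssubset hX) ((Finset.erase_subset X S).trans hS)

/-- **Pearl's theorem**: the factor `⟦B⟧ = ⊙_{X∈𝕏} φ^X` associated to a
Bayesian network `B` over `𝕏` is a probability distribution over `𝕏`, i.e.
`∑_{x̄ ∈ Val(𝕏)} ⟦B⟧(x̄) = 1` (the sum over all assignments of the variables of
`B`, the remaining names being fixed arbitrarily, equals `1`). -/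
theorem pearl {V : ℕ → Type} [∀ x, Fintype (V x)] [∀ x, Nonempty (V x)]
    (B : BayesNet V) (a : ∀ x : ℕ, V x) :
    ∑ w : (∀ x : ↥B.vars, V ↑x),
      B.sem.f (fun y => if h : y ∈ B.vars then w ⟨y, h⟩ else a y) = 1 := by
  rw [← B.sumOver_prod_table B.vars subset_rfl a, sumOver]
  refine Finset.sum_congr rfl fun w _ => ?_
  rw [B.sem_f, ← Finset.prod_attach B.vars]
  exact Finset.prod_congr rfl fun X _ => by rw [BayesNet.table, dif_pos X.2]

end HOBN
end
end

section
/- Distributivity of sum-out over factor product: let φ₁ be a factor over 𝕏₁ and φ₂ a factor over 𝕏₂, and let ℤ ⊆ 𝕏₂ with ℤ ∩ 𝕏₁ = ∅. Then ∑_ℤ (φ₁ ⊙ φ₂) = φ₁ ⊙ (∑_ℤ φ₂). -/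
set_option maxHeartbeats 1000000

noncomputable section
open Classical

namespace HOBN

/-! Fix a countable set of names (represented by `ℕ`); each name `X` carries a
type `V X` of values, assumed finite and nonempty. -/

variable {V : ℕ → Type}

theorem Factor.eq_of_names_eq_of_f_eq {φ ψ : Factor V} (hn : φ.names = ψ.names)
    (hf : φ.f = ψ.f) : φ = ψ := by
  cases φ
  cases ψ
  cases hn
  cases hf
  rfl

/-- A sum-out may be computed over any description of the set of names summed out. -/
theorem Factor.sumOut_f_eq [∀ x, Fintype (V x)] {Z S : Finset ℕ} (φ : Factor V)
    (hS : φ.names ∩ Z = S) (a : ∀ x, V x) :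
    (Factor.sumOut Z φ).f a =
      ∑ w : (∀ x : ↥S, V ↑x), φ.f (fun x => if hx : x ∈ S then w ⟨x, hx⟩ else a x) := by
  subst hS
  rfl

/-- **Distributivity of sum-out over factor product**: if `φ₁` is a factor
over `𝕏₁`, `φ₂` a factor over `𝕏₂`, and `Z ⊆ 𝕏₂` with `Z ∩ 𝕏₁ = ∅`, then
`∑_Z (φ₁ ⊙ φ₂) = φ₁ ⊙ (∑_Z φ₂)`. -/
theorem sumOut_prod_distrib {V : ℕ → Type} [∀ x, Fintype (V x)] [∀ x, Nonempty (V x)]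
    (φ₁ φ₂ : Factor V) (Z : Finset ℕ)
    (hZ : Z ⊆ φ₂.names) (hdisj : Disjoint Z φ₁.names) :
    Factor.sumOut Z (φ₁.prod φ₂) = φ₁.prod (Factor.sumOut Z φ₂) := by
  have hinter : (φ₁.prod φ₂).names ∩ Z = Z :=
    Finset.inter_eq_right.mpr (hZ.trans Finset.subset_union_right)
  refine Factor.eq_of_names_eq_of_f_eq ?_ ?_
  · change (φ₁.names ∪ φ₂.names) \ Z = φ₁.names ∪ φ₂.names \ Z
    rw [Finset.union_sdiff_distrib, Finset.sdiff_eq_self_of_disjoint hdisj.symm]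
  · funext a
    change _ = φ₁.f a * (Factor.sumOut Z φ₂).f a
    rw [Factor.sumOut_f_eq _ hinter, Factor.sumOut_f_eq _ (Finset.inter_eq_right.mpr hZ),
      Finset.mul_sum]
    refine Finset.sum_congr rfl fun w _ => congrArg (· * _) (φ₁.supp _ _ fun x hx => ?_)
    exact dif_neg (Finset.disjoint_right.mp hdisj hx)

end HOBN
end
end
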